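/- arXiv:2003.06270 — 2 statements merged into one kernel-verified Lean document; each statement's English description precedes it below -/
import Mathlib

section
/- Let M be a closed, oriented manifold of dimension m, let X be a geodesible vector field on M, and set F = ⟨X⟩. Then the pairing (⟦α⟧_X, [σ]_B) ↦ ∫_M α∧σ from C_X × H_B^{m−1}(F) to ℝ is well defined: the value of ∫_M α∧σ is unchanged if α ∈ Ω_X^1 is replaced by α' ∈ Ω_X^1 with α'(X) = α(X), or if the closed basic (m−1)-form σ is replaced by σ + dτ with τ a basic (m−2)-form. -/
open scoped BigOperators

/-- An abstract model of the calculus of smooth differential forms on a smooth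
manifold `M`: `Ω` is the graded-commutative ℝ-algebra of smooth differential
forms on `M` (multiplication is the wedge product `∧`, and `1` is the constant
function `1`), `grade k` is the submodule of `k`-forms, `d` is the exterior
derivative, `dim` is the dimension of `M`, `VF` is the space of smooth vector
fields on `M`, `iV X` is the interior product (contraction) with the vector
field `X`, `fn` assigns to a `0`-form the corresponding smooth real-valued
function on `M`, `NowhereZero ω` says that the differential form `ω` vanishes
nowhere on `M`, and `Nonsingular X` says that the vector field `X` has no
zeros.  The axioms are the standard rules of the exterior calculus. -/
structure SmoothCalculus (M : Type*) where
  /-- the differential forms on `M`, with the wedge product as multiplication -/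
  Ω : Type*
  [ringΩ : Ring Ω]
  [algΩ : Algebra ℝ Ω]
  /-- the submodule of `k`-forms -/
  grade : ℕ → Submodule ℝ Ω
  /-- the exterior derivative -/
  d : Ω →ₗ[ℝ] Ω
  /-- the dimension of the manifold `M` -/
  dim : ℕ
  /-- the smooth vector fields on `M` -/
  VF : Type*
  /-- the interior product (contraction) of a form with a vector field -/
  iV : VF → Ω →ₗ[ℝ] Ω
  /-- evaluation of a `0`-form as a real-valued function on `M` -/
  fn : Ω → M → ℝ
  /-- `NowhereZero ω`: the differential form `ω` is nowhere vanishing on `M` -/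
  NowhereZero : Ω → Prop
  /-- `Nonsingular X`: the vector field `X` has no zeros -/
  Nonsingular : VF → Prop
  grade_d : ∀ {k : ℕ} {ω : Ω}, ω ∈ grade k → d ω ∈ grade (k + 1)
  grade_mul : ∀ {k l : ℕ} {ω η : Ω}, ω ∈ grade k → η ∈ grade l → ω * η ∈ grade (k + l)
  one_mem_grade : (1 : Ω) ∈ grade 0
  grade_top : ∀ {k : ℕ}, dim < k → grade k = ⊥
  d_d : ∀ ω : Ω, d (d ω) = 0
  /-- the graded Leibniz rule for the exterior derivative -/
  leibniz : ∀ {k : ℕ} (ω η : Ω), ω ∈ grade k →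
    d (ω * η) = d ω * η + ((-1 : ℝ) ^ k) • (ω * d η)
  /-- graded commutativity of the wedge product -/
  graded_comm : ∀ {k l : ℕ} (ω η : Ω), ω ∈ grade k → η ∈ grade l →
    ω * η = ((-1 : ℝ) ^ (k * l)) • (η * ω)
  iV_grade : ∀ (X : VF) {k : ℕ} {ω : Ω}, ω ∈ grade (k + 1) → iV X ω ∈ grade k
  iV_grade_zero : ∀ (X : VF) {ω : Ω}, ω ∈ grade 0 → iV X ω = 0
  /-- the interior product is a graded antiderivation -/
  iV_mul : ∀ (X : VF) {k : ℕ} (ω η : Ω), ω ∈ grade k →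
    iV X (ω * η) = iV X ω * η + ((-1 : ℝ) ^ k) • (ω * iV X η)
  fn_one : fn 1 = fun _ => 1

attribute [instance] SmoothCalculus.ringΩ SmoothCalculus.algΩ

namespace SmoothCalculus

variable {M : Type*} (C : SmoothCalculus M)

/-- The Lie derivative of a differential form along a vector field, given by
Cartan's formula `L_X ω = i_X (dω) + d (i_X ω)`. -/
def lieD (X : C.VF) (ω : C.Ω) : C.Ω := C.iV X (C.d ω) + C.d (C.iV X ω)

/-- Integration of differential forms over the closed, oriented manifold `M`:
`integral ω` is the integral `∫_M ω` of (the top-degree part of) `ω`.  By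
Stokes's theorem on a closed manifold, the integral of any exact form
vanishes. -/
structure OrientedIntegration where
  /-- the integral `∫_M` of (the top-degree part of) a differential form -/
  integral : C.Ω →ₗ[ℝ] ℝ
  /-- Stokes's theorem on the closed manifold `M` -/
  integral_d : ∀ ω : C.Ω, integral (C.d ω) = 0

/-- A 1-form `α` is a characteristic 1-form of the vector field `X` if
`α(X) = 1` and `i_X dα = 0`. -/
def IsCharacteristic (X : C.VF) (α : C.Ω) : Prop :=
  α ∈ C.grade 1 ∧ C.iV X α = 1 ∧ C.iV X (C.d α) = 0

/-- A nonsingular vector field `X` is geodesible if there is a Riemannian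
metric on `M` for which `X` has unit length and the flow lines of `X` are
geodesics; by the theorem of Wadsley and Sullivan this holds if and only if
`X` admits a characteristic 1-form, i.e. a 1-form `α` with `α(X) = 1` and
`i_X dα = 0`, which is the characterisation used here. -/
def Geodesible (X : C.VF) : Prop := ∃ α, C.IsCharacteristic X α

/-- A differential form `ω` is basic for the foliation `⟨X⟩` spanned by `X` if
`i_X ω = 0` and `i_X dω = 0`. -/
def Basic (X : C.VF) (ω : C.Ω) : Prop := C.iV X ω = 0 ∧ C.iV X (C.d ω) = 0

end SmoothCalculus

namespace SmoothCalculus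

/-- `α ∈ Ω_X^1`: the 1-form `α` satisfies `α(X) = c` for some positive
constant `c`, and `i_X dα = 0`.  The space `C_X` is the quotient of `Ω_X^1` by
the relation `α ∼ β ⟺ α(X) = β(X)`. -/
def MemOmegaX {M : Type*} (C : SmoothCalculus M) (X : C.VF) (α : C.Ω) : Prop :=
  α ∈ C.grade 1 ∧ (∃ c : ℝ, 0 < c ∧ C.iV X α = c • (1 : C.Ω)) ∧ C.iV X (C.d α) = 0

end SmoothCalculus

open SmoothCalculus

namespace SmoothCalculus

/-- A form of degree at least `dim M` which is annihilated by `i_X` vanishes, provided `X` admits a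
characteristic 1-form. -/
theorem Geodesible.eq_zero_of_iV_eq_zero {M : Type*} {C : SmoothCalculus M} {X : C.VF}
    (hX : C.Geodesible X) {k : ℕ} (hk : C.dim ≤ k) {ω : C.Ω} (hω : ω ∈ C.grade k)
    (h : C.iV X ω = 0) : ω = 0 := by
  obtain ⟨β, hβ, hβX, -⟩ := hX
  have hzero : β * ω = 0 := by
    have hmem := C.grade_mul hβ hω
    rwa [C.grade_top (by omega), Submodule.mem_bot] at hmem
  have hmul := C.iV_mul X β ω hβ
  rw [hzero, hβX, h] at hmul
  simpa using hmul.symm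

end SmoothCalculus

/-- Let `M` be a closed, oriented manifold of dimension `m` and `X` a
geodesible vector field on `M`; set `F = ⟨X⟩`.  Then the pairing
`(⟦α⟧_X, [σ]_B) ↦ ∫_M α ∧ σ` from `C_X × H_B^{m−1}(F)` to `ℝ` is well
defined: the value of `∫_M α ∧ σ` is unchanged if `α ∈ Ω_X^1` is replaced by
`α' ∈ Ω_X^1` with `α'(X) = α(X)`, and unchanged if the closed basic
`(m−1)`-form `σ` is replaced by `σ + dτ` with `τ` a basic `(m−2)`-form. -/
theorem pairing_well_defined {M : Type*} [TopologicalSpace M] [CompactSpace M]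
    (C : SmoothCalculus M) (I : C.OrientedIntegration) {m : ℕ} (hdim : C.dim = m)
    (X : C.VF) (hgeo : C.Geodesible X)
    {α α' σ τ : C.Ω}
    (hα : MemOmegaX C X α) (hα' : MemOmegaX C X α') (hαα' : C.iV X α = C.iV X α')
    (hσ : σ ∈ C.grade (m - 1)) (hσB : C.Basic X σ) (hσcl : C.d σ = 0)
    (hτ : τ ∈ C.grade (m - 2)) (hτB : C.Basic X τ) :
    I.integral (α' * σ) = I.integral (α * σ) ∧
      I.integral (α * (σ + C.d τ)) = I.integral (α * σ) := by
  constructor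
  · have hdiff : α' - α ∈ C.grade 1 := sub_mem hα'.1 hα.1
    have hzero : (α' - α) * σ = 0 := by
      refine hgeo.eq_zero_of_iV_eq_zero (by omega) (C.grade_mul hdiff hσ) ?_
      rw [C.iV_mul X _ _ hdiff, map_sub, hαα', hσB.1]
      simp
    rw [← sub_eq_zero, ← map_sub, ← sub_mul, hzero, map_zero]
  · have hdα := C.grade_d hα.1
    have hzero : C.d α * τ = 0 := by
      refine hgeo.eq_zero_of_iV_eq_zero (by omega) (C.grade_mul hdα hτ) ?_
      rw [C.iV_mul X _ _ hdα, hα.2.2, hτB.1]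
      simp
    have hstokes := I.integral_d (α * τ)
    rw [C.leibniz α τ hα.1, hzero] at hstokes
    have hexact : I.integral (α * C.d τ) = 0 := by simpa using hstokes
    rw [mul_add, map_add, hexact, add_zero]
end

section
/- Let X be a geodesible vector field on a closed manifold M. The Euler class e_X ∈ H_B^2(⟨X⟩) vanishes if and only if there exists a codimension-1 foliation T of M transverse to X and invariant under the flow of X. -/
open scoped BigOperators

open SmoothCalculus

namespace SmoothCalculus

variable {M : Type*} (C : SmoothCalculus M)

theorem d_one : C.d 1 = 0 := by
  simpa using C.leibniz 1 1 C.one_mem_grade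

theorem mul_self_of_mem_grade_one {β : C.Ω} (hβ : β ∈ C.grade 1) : β * β = 0 := by
  have h := C.graded_comm β β hβ hβ
  have h2 : (2 : ℝ) • (β * β) = 0 := by
    rw [two_smul]
    nth_rewrite 1 [h]
    simp
  exact (smul_eq_zero_iff_right two_ne_zero).mp h2

/-- A 1-form `β` with `β(X) = 1` that is integrable and whose kernel is invariant under the flow
of `X` is closed. -/
theorem d_eq_zero_of_integrable_of_invariant {X : C.VF} {β f : C.Ω} (hβ : β ∈ C.grade 1)
    (hX : C.iV X β = 1) (hint : β * C.d β = 0) (hf : f ∈ C.grade 0)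
    (hL : C.lieD X β = f * β) : C.d β = 0 := by
  have hiX : C.iV X (C.d β) = f * β := by simpa [lieD, hX, C.d_one] using hL
  have hcomm : β * f = f * β := by simpa using C.graded_comm β f hβ hf
  have hmul : β * (f * β) = 0 := by
    rw [← mul_assoc, hcomm, mul_assoc, C.mul_self_of_mem_grade_one hβ, mul_zero]
  simpa [hint, hX, hiX, hmul] using (C.iV_mul X β (C.d β) hβ).symm

end SmoothCalculus

/-- The Euler class `e_X ∈ H_B²(⟨X⟩)` of a geodesible vector field `X` on a
closed manifold `M` vanishes (i.e. `dα = dγ` for a characteristic 1-form `α`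
of `X` and a basic 1-form `γ`) if and only if `X` admits a transverse
invariant codimension-one foliation `T`.  Such a foliation, being transverse
to `X` and hence cooriented by `X`, is exactly the kernel of a 1-form `β` with
`β(X) = 1` which is integrable (Frobenius: `β ∧ dβ = 0`) and invariant under
the flow of `X` (`L_X β = f·β` for a smooth function `f`). -/
theorem euler_class_zero_iff_transverse_invariant_foliation {M : Type*}
    [TopologicalSpace M] [CompactSpace M]
    (C : SmoothCalculus M) (X : C.VF) (hgeo : C.Geodesible X) :
    (∃ α γ, C.IsCharacteristic X α ∧ γ ∈ C.grade 1 ∧ C.Basic X γ ∧ C.d α = C.d γ) ↔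
      ∃ β ∈ C.grade 1, C.iV X β = 1 ∧ β * C.d β = 0 ∧
        ∃ f ∈ C.grade 0, C.lieD X β = f * β := by
  constructor
  · rintro ⟨α, γ, ⟨hα, hαX, -⟩, hγ, ⟨hγX, -⟩, hd⟩
    have hclosed : C.d (α - γ) = 0 := by rw [map_sub, hd, sub_self]
    have hX : C.iV X (α - γ) = 1 := by rw [map_sub, hαX, hγX, sub_zero]
    refine ⟨α - γ, sub_mem hα hγ, hX, by rw [hclosed, mul_zero], 0, zero_mem _, ?_⟩
    rw [SmoothCalculus.lieD, hclosed, hX, map_zero, C.d_one, add_zero, zero_mul]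
  · rintro ⟨β, hβ, hX, hint, f, hf, hL⟩
    have hclosed : C.d β = 0 := C.d_eq_zero_of_integrable_of_invariant hβ hX hint hf hL
    refine ⟨β, 0, ⟨hβ, hX, ?_⟩, zero_mem _, ⟨map_zero _, ?_⟩, ?_⟩ <;> simp [hclosed]
end
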